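/- For every Boolean circuit C with n inputs and m gates, containing no other gates than ¬-gates, ∨-gates and ∧-gates, there exists an instruction sequence X ∈ IS_br in which no primitive instruction contains the basic instruction out.set:false, such that X computes the n-ary Boolean function induced by C and psize(X) ≤ c·(n + m + 1) for a constant c independent of C. -/

import Mathlib

/-- Boolean register names: `inp i` is input register `in:(i+1)`,
`aux i` is auxiliary register `aux:(i+1)`, `out` is the output register. -/
inductive Reg where
  | inp : ℕ → Reg
  | aux : ℕ → Reg
  | out : Reg
deriving DecidableEq

/-- Basic instructions: register reads/writes, and (for splitting instruction
sequences) `split p` and `reply p` for Boolean parameters `p`. -/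
inductive BInstr where
  | get : Reg → BInstr
  | set : Reg → Bool → BInstr
  | split : ℕ → BInstr
  | reply : ℕ → BInstr
deriving DecidableEq

/-- Primitive instructions. -/
inductive PInstr where
  | plain : BInstr → PInstr
  | pos : BInstr → PInstr
  | neg : BInstr → PInstr
  | jump : ℕ → PInstr
  | halt : PInstr
deriving DecidableEq

abbrev RegState := Reg → Bool

/-- State change caused by processing a basic instruction. -/
def BInstr.effect : BInstr → RegState → RegState
  | .set r b, s => Function.update s r b
  | _, s => s

/-- Reply produced by processing a basic instruction. -/
def BInstr.rpl : BInstr → RegState → Bool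
  | .get r, s => s r
  | .set _ b, _ => b
  | _, _ => false

def BInstr.isSplitReply : BInstr → Bool
  | .split _ => true
  | .reply _ => true
  | _ => false

/-- Single-thread execution of an instruction sequence on Boolean registers;
`none` means deadlock, `some s` means termination in register state `s`.
(`split`/`reply` instructions make no sense here and deadlock.) -/
def exec : List PInstr → RegState → Option RegState
  | [], _ => none
  | .plain a :: X, s =>
      if a.isSplitReply then none else exec X (a.effect s)
  | .pos a :: X, s =>
      if a.isSplitReply then none
      else if a.rpl s then exec X (a.effect s) else exec (X.drop 1) (a.effect s)
  | .neg a :: X, s =>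
      if a.isSplitReply then none
      else if a.rpl s then exec (X.drop 1) (a.effect s) else exec X (a.effect s)
  | .jump 0 :: _, _ => none
  | .jump (l+1) :: X, s => exec (X.drop l) s
  | .halt :: _, s => some s
termination_by X _ => X.length
decreasing_by all_goals (simp only [List.length_drop, List.length_cons]; omega)

/-- Initial register state: input registers `in:1 .. in:n` contain
`b 0, ..., b (n-1)`; all other registers contain `false`. -/
def initState (n : ℕ) (b : Fin n → Bool) : RegState := fun r =>
  match r with
  | .inp i => if h : i < n then b ⟨i, h⟩ else false
  | _ => false

/-- `X` computes the `n`-ary Boolean function `f`: for every input, execution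
terminates (does not deadlock) with the output register containing `f b`. -/
def Computes {n : ℕ} (f : (Fin n → Bool) → Bool) (X : List PInstr) : Prop :=
  ∀ b : Fin n → Bool, ∃ s : RegState,
    exec X (initState n b) = some s ∧ s Reg.out = f b

/-- Basic instructions allowed in `IS_br`. -/
def BrBasic : BInstr → Prop
  | .get (.inp _) => True
  | .get (.aux _) => True
  | .set (.aux _) _ => True
  | .set .out _ => True
  | _ => False

/-- Basic instructions allowed in `IS_br^na`. -/
def NaBasic : BInstr → Prop
  | .get (.inp _) => True
  | .set .out _ => True
  | _ => False

def InstrBasicOK (P : BInstr → Prop) : PInstr → Prop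
  | .plain a => P a
  | .pos a => P a
  | .neg a => P a
  | _ => True

/-- Membership of `IS_br` (non-empty, only allowed basic instructions). -/
def ISbr (X : List PInstr) : Prop :=
  X ≠ [] ∧ ∀ u ∈ X, InstrBasicOK BrBasic u

/-- Membership of `IS_br^na`. -/
def ISbrna (X : List PInstr) : Prop :=
  X ≠ [] ∧ ∀ u ∈ X, InstrBasicOK NaBasic u

/-- The primitive instruction contains the basic instruction `out.set:false`. -/
def UsesOutSetFalse : PInstr → Prop
  | .plain (.set .out false) => True
  | .pos (.set .out false) => True
  | .neg (.set .out false) => True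
  | _ => False

/-- The class PLIS of Boolean function families computable by
polynomial-length instruction sequences from `IS_br`. -/
def PLIS (F : (n : ℕ) → (Fin n → Bool) → Bool) : Prop :=
  ∃ h : Polynomial ℕ, ∀ n : ℕ, ∃ X : List PInstr,
    ISbr X ∧ Computes (F n) X ∧ X.length ≤ h.eval n

/-- A gate at position `k` (0-based) of a circuit with `n` inputs: a ¬-, ∨- or
∧-gate whose predecessors are input nodes (`Sum.inl`) or earlier gates
(`Sum.inr`, with index `< k`). -/
inductive GateDef (n k : ℕ) where
  | gnot : (Fin n ⊕ Fin k) → GateDef n k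
  | gor : (Fin n ⊕ Fin k) → (Fin n ⊕ Fin k) → GateDef n k
  | gand : (Fin n ⊕ Fin k) → (Fin n ⊕ Fin k) → GateDef n k

/-- A Boolean circuit with `n` inputs and `m` gates, listed in topological
order. -/
structure Circuit (n m : ℕ) where
  gate : (k : Fin m) → GateDef n k.1

/-- The value of gate `k` of the circuit on input `b`. -/
def Circuit.nodeVal {n m : ℕ} (C : Circuit n m) (b : Fin n → Bool)
    (k : ℕ) (hk : k < m) : Bool :=
  let pv : Fin n ⊕ Fin k → Bool := fun x =>
    match x with
    | .inl i => b i
    | .inr j => C.nodeVal b j.1 (j.2.trans hk)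
  match C.gate ⟨k, hk⟩ with
  | .gnot x => !(pv x)
  | .gor x y => pv x || pv y
  | .gand x y => pv x && pv y
termination_by k

/-- The register holding the value of a node: input registers for input nodes,
auxiliary registers for gates. -/
def nodeReg {n k : ℕ} : Fin n ⊕ Fin k → Reg
  | .inl i => .inp i
  | .inr j => .aux j

/-- Code that stores the value of gate `k` in auxiliary register `aux k`,
provided that register contains `false` beforehand. -/
def GateDef.code {n k : ℕ} : GateDef n k → List PInstr
  | .gnot x => [.neg (.get (nodeReg x)), .plain (.set (.aux k) true)]
  | .gor x y =>
      [.pos (.get (nodeReg x)), .plain (.set (.aux k) true),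
       .pos (.get (nodeReg y)), .plain (.set (.aux k) true)]
  | .gand x y =>
      [.neg (.get (nodeReg x)), .jump 3,
       .pos (.get (nodeReg y)), .plain (.set (.aux k) true)]

/-- The value of a gate, given the values of its predecessors. -/
def GateDef.eval {n k : ℕ} (v : Fin n ⊕ Fin k → Bool) : GateDef n k → Bool
  | .gnot x => !(v x)
  | .gor x y => v x || v y
  | .gand x y => v x && v y

/-- Code for the first `k` gates of a circuit. -/
def Circuit.code {n m : ℕ} (C : Circuit n m) : (k : ℕ) → k ≤ m → List PInstr
  | 0, _ => []
  | k + 1, h => C.code k (Nat.le_of_succ_le h) ++ (C.gate ⟨k, h⟩).code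

theorem GateDef.exec_code_append {n k : ℕ} (g : GateDef n k) (rest : List PInstr)
    (s : RegState) (hs : s (.aux k) = false) :
    exec (g.code ++ rest) s =
      exec rest (Function.update s (.aux k) (g.eval fun x => s (nodeReg x))) := by
  have hupd : Function.update s (.aux k) false = s := by
    rw [← hs, Function.update_eq_self]
  have hne : ∀ x : Fin n ⊕ Fin k, nodeReg x ≠ .aux k := by
    rintro (i | j)
    · simp [nodeReg]
    · simpa [nodeReg] using j.2.ne
  cases g with
  | gnot x =>
    cases hx : s (nodeReg x) <;>
      simp [code, eval, exec, BInstr.isSplitReply, BInstr.rpl, BInstr.effect, hx, hupd]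
  | gor x y =>
    cases hx : s (nodeReg x) <;> cases hy : s (nodeReg y) <;>
      simp [code, eval, exec, BInstr.isSplitReply, BInstr.rpl, BInstr.effect, hx, hy, hupd, hne]
  | gand x y =>
    cases hx : s (nodeReg x) <;> cases hy : s (nodeReg y) <;>
      simp [code, eval, exec, BInstr.isSplitReply, BInstr.rpl, BInstr.effect, hx, hy, hupd]

theorem GateDef.length_code_le {n k : ℕ} (g : GateDef n k) : g.code.length ≤ 4 := by
  cases g <;> simp [code]

theorem GateDef.code_ok {n k : ℕ} (g : GateDef n k) :
    ∀ u ∈ g.code, InstrBasicOK BrBasic u ∧ ¬ UsesOutSetFalse u := by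
  have hreg : ∀ x : Fin n ⊕ Fin k, BrBasic (.get (nodeReg x)) := by
    rintro (i | j) <;> trivial
  have hset : BrBasic (.set (.aux k) true) := trivial
  cases g <;> simp [code, InstrBasicOK, UsesOutSetFalse, hreg, hset]

theorem Circuit.nodeVal_eq_eval {n m : ℕ} (C : Circuit n m) (b : Fin n → Bool)
    (k : ℕ) (hk : k < m) :
    C.nodeVal b k hk =
      (C.gate ⟨k, hk⟩).eval (Sum.elim b fun j => C.nodeVal b j.1 (j.2.trans hk)) := by
  have hv : (fun x : Fin n ⊕ Fin k => match x with
      | .inl i => b i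
      | .inr j => C.nodeVal b j.1 (j.2.trans hk)) =
      Sum.elim b fun j => C.nodeVal b j.1 (j.2.trans hk) := by
    funext x
    cases x <;> rfl
  rw [← hv, Circuit.nodeVal]
  cases C.gate ⟨k, hk⟩ <;> rfl

theorem Circuit.length_code_le {n m : ℕ} (C : Circuit n m) (k : ℕ) (hk : k ≤ m) :
    (C.code k hk).length ≤ 4 * k := by
  induction k with
  | zero => simp [code]
  | succ k ih =>
    have h₁ := ih (Nat.le_of_succ_le hk)
    have h₂ := (C.gate ⟨k, hk⟩).length_code_le
    simp only [code, List.length_append]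
    omega

theorem Circuit.code_ok {n m : ℕ} (C : Circuit n m) (k : ℕ) (hk : k ≤ m) :
    ∀ u ∈ C.code k hk, InstrBasicOK BrBasic u ∧ ¬ UsesOutSetFalse u := by
  induction k with
  | zero => simp [code]
  | succ k ih =>
    intro u hu
    rcases List.mem_append.1 hu with hu | hu
    · exact ih _ u hu
    · exact GateDef.code_ok _ u hu

/-- The registers after the values of the first `k` gates have been computed. -/
def Circuit.HoldsValues {n m : ℕ} (C : Circuit n m) (b : Fin n → Bool) (k : ℕ)
    (s : RegState) : Prop :=
  (∀ i : Fin n, s (.inp i) = b i) ∧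
  (∀ j (hj : j < m), j < k → s (.aux j) = C.nodeVal b j hj) ∧
  (∀ j, k ≤ j → s (.aux j) = false) ∧
  s .out = false

theorem Circuit.exec_code_append {n m : ℕ} (C : Circuit n m) (b : Fin n → Bool)
    (k : ℕ) (hk : k ≤ m) (rest : List PInstr) :
    ∃ s, C.HoldsValues b k s ∧
      exec (C.code k hk ++ rest) (initState n b) = exec rest s := by
  induction k generalizing rest with
  | zero => exact ⟨initState n b, by simp [HoldsValues, initState], rfl⟩
  | succ k ih =>
    obtain ⟨s, ⟨hinp, hval, hfalse, hout⟩, hs⟩ :=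
      ih (Nat.le_of_succ_le hk) ((C.gate ⟨k, hk⟩).code ++ rest)
    have hpred : (fun x => s (nodeReg x)) =
        Sum.elim b fun j : Fin k => C.nodeVal b j.1 (j.2.trans hk) := by
      funext x
      cases x with
      | inl i => exact hinp i
      | inr j => exact hval j _ j.2
    refine ⟨Function.update s (.aux k) (C.nodeVal b k hk), ⟨?_, ?_, ?_, ?_⟩, ?_⟩
    · simpa using hinp
    · intro j hj hjk
      rcases Nat.lt_succ_iff_lt_or_eq.1 hjk with h | rfl
      · simpa [h.ne] using hval j hj h
      · simp
    · intro j hj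
      have hne : j ≠ k := by omega
      simpa [hne] using hfalse j (by omega)
    · simpa using hout
    · rw [code, List.append_assoc, hs, GateDef.exec_code_append _ _ _ (hfalse k le_rfl),
        C.nodeVal_eq_eval, hpred]

/-- Theorem 5 of the paper: the Boolean function induced by a Boolean circuit
(with ¬-, ∨- and ∧-gates only) is computed by an instruction sequence from
`IS_br` of linear length in which `out.set:false` does not occur. -/
theorem statement5 :
    ∃ c : ℕ, ∀ (n m : ℕ) (C : Circuit n (m + 1)),
      ∃ X : List PInstr, ISbr X ∧
        (∀ u ∈ X, ¬ UsesOutSetFalse u) ∧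
        Computes (fun b => C.nodeVal b m (Nat.lt_succ_self m)) X ∧
        X.length ≤ c * (n + (m + 1) + 1) := by
  refine ⟨4, fun n m C => ⟨C.code (m + 1) le_rfl ++
    [.pos (.get (.aux m)), .plain (.set .out true), .halt], ?_⟩⟩
  have hok : ∀ u ∈ C.code (m + 1) le_rfl ++
      [.pos (.get (.aux m)), .plain (.set .out true), .halt],
      InstrBasicOK BrBasic u ∧ ¬ UsesOutSetFalse u := by
    intro u hu
    rcases List.mem_append.1 hu with hu | hu
    · exact C.code_ok _ _ u hu
    · simp only [List.mem_cons, List.not_mem_nil, or_false] at hu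
      rcases hu with rfl | rfl | rfl <;> simp [InstrBasicOK, BrBasic, UsesOutSetFalse]
  refine ⟨⟨by simp, fun u hu => (hok u hu).1⟩, fun u hu => (hok u hu).2, fun b => ?_, ?_⟩
  · obtain ⟨s, ⟨-, hval, -, hout⟩, hs⟩ := C.exec_code_append b (m + 1) le_rfl
      [.pos (.get (.aux m)), .plain (.set .out true), .halt]
    rw [hs]
    have hm := hval m (Nat.lt_succ_self m) (Nat.lt_succ_self m)
    cases hv : C.nodeVal b m (Nat.lt_succ_self m) <;> rw [hv] at hm <;>
      simp [exec, BInstr.isSplitReply, BInstr.rpl, BInstr.effect, hm, hout, hv]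
  · have h := C.length_code_le (m + 1) le_rfl
    simp only [List.length_append, List.length_cons, List.length_nil]
    omega
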